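/- If the nonlinear connection on T*M is induced by a linear connection ∇ on M (N_{ij} = −p_k Γ^k_{ij}), then the horizontal lift w^H of a Poisson structure w on M is a Poisson bivector on T*M if and only if R_∇(♯_w α, ♯_w β)Z = 0 for all 1-forms α,β and vector fields Z on M, equivalently iff the curvature C_D of the contravariant connection D = ∇_{♯_w ·} induced by ∇ vanishes. -/

import Mathlib

open scoped BigOperators
noncomputable section

/-- The model of the base manifold `M`: global coordinates `(x^i)` on an `n`-dimensional chart. -/
abbrev Vec (n : ℕ) := Fin n → ℝ
/-- The model of the cotangent bundle `T*M`: points `(x, p)`. -/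
abbrev Cot (n : ℕ) := Vec n × Vec n
/-- Index type for the `2n` coordinates `(x^i, p_i)` of `T*M`. -/
abbrev Idx (n : ℕ) := Fin n ⊕ Fin n

/-- Smoothness. -/
def Sm {E F : Type*} [NormedAddCommGroup E] [NormedSpace ℝ E]
    [NormedAddCommGroup F] [NormedSpace ℝ F] (f : E → F) : Prop := ContDiff ℝ (⊤ : ℕ∞) f

/-- Partial derivative `∂f/∂x^i` on the base. -/
def pd {n : ℕ} (i : Fin n) (f : Vec n → ℝ) (x : Vec n) : ℝ := fderiv ℝ f x (Pi.single i 1)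

/-- Coordinate direction in `T*M`. -/
def dirOf {n : ℕ} : Idx n → Cot n
  | Sum.inl i => (Pi.single i 1, 0)
  | Sum.inr i => (0, Pi.single i 1)

/-- Partial derivative on `T*M` in the direction of the `a`-th coordinate. -/
def DT {n : ℕ} (a : Idx n) (F : Cot n → ℝ) (z : Cot n) : ℝ := fderiv ℝ F z (dirOf a)
/-- `∂/∂x^i` on `T*M`. -/
def Dxx {n : ℕ} (i : Fin n) : (Cot n → ℝ) → Cot n → ℝ := DT (Sum.inl i)
/-- `∂/∂p_i` on `T*M`. -/
def Dpp {n : ℕ} (i : Fin n) : (Cot n → ℝ) → Cot n → ℝ := DT (Sum.inr i)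

/-- A bivector field on `T*M`, given by its component matrix `W^{AB}`
(the bivector is `(1/2) W^{AB} ∂_A ∧ ∂_B`). -/
abbrev Biv (n : ℕ) := Cot n → Idx n → Idx n → ℝ

/-- The bracket of functions on `T*M` defined by a bivector field `W`. -/
def bkt {n : ℕ} (W : Biv n) (F G : Cot n → ℝ) (z : Cot n) : ℝ :=
  ∑ a : Idx n, ∑ b : Idx n, W z a b * DT a F z * DT b G z

/-- The bracket of functions on `M` defined by a bivector field `w` on `M`
(components `w^{ij}`, the bivector being `(1/2) w^{ij} ∂_i ∧ ∂_j`). -/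
def bktM {n : ℕ} (w : Vec n → Fin n → Fin n → ℝ) (f g : Vec n → ℝ) (x : Vec n) : ℝ :=
  ∑ i, ∑ j, w x i j * pd i f x * pd j g x

def SkewT {n : ℕ} (W : Biv n) : Prop := ∀ z a b, W z a b = - W z b a
def SmoothT {n : ℕ} (W : Biv n) : Prop := ∀ a b, Sm fun z => W z a b
/-- The Jacobi identity for the bracket of `W`, i.e. `[W,W] = 0`. -/
def JacobiT {n : ℕ} (W : Biv n) : Prop :=
  ∀ F G H : Cot n → ℝ, Sm F → Sm G → Sm H → ∀ z,
    bkt W (bkt W F G) H z + bkt W (bkt W G H) F z + bkt W (bkt W H F) G z = 0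

def SkewM {n : ℕ} (w : Vec n → Fin n → Fin n → ℝ) : Prop := ∀ x i j, w x i j = - w x j i
def SmoothM {n : ℕ} (w : Vec n → Fin n → Fin n → ℝ) : Prop := ∀ i j, Sm fun x => w x i j
def JacobiM {n : ℕ} (w : Vec n → Fin n → Fin n → ℝ) : Prop :=
  ∀ f g h : Vec n → ℝ, Sm f → Sm g → Sm h → ∀ x,
    bktM w (bktM w f g) h x + bktM w (bktM w g h) f x + bktM w (bktM w h f) g x = 0

/-- A Poisson structure on `T*M`. -/
def PoissonT {n : ℕ} (W : Biv n) : Prop := SkewT W ∧ SmoothT W ∧ JacobiT W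
/-- A Poisson structure on `M`. -/
def PoissonM {n : ℕ} (w : Vec n → Fin n → Fin n → ℝ) : Prop := SkewM w ∧ SmoothM w ∧ JacobiM w

/-- `F : T*M → ℝ` is a fiberwise polynomial of degree `≤ k`. -/
def PolyDeg {n : ℕ} (k : ℕ) (F : Cot n → ℝ) : Prop :=
  ∃ P : Vec n → MvPolynomial (Fin n) ℝ, (∀ x, (P x).totalDegree ≤ k) ∧
    ∀ x p, F (x, p) = MvPolynomial.eval p (P x)

/-- `F : T*M → ℝ` is a fiberwise homogeneous polynomial of degree `k`. -/
def HomogPoly {n : ℕ} (k : ℕ) (F : Cot n → ℝ) : Prop :=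
  ∃ P : Vec n → MvPolynomial (Fin n) ℝ, (∀ x, (P x).IsHomogeneous k) ∧
    ∀ x p, F (x, p) = MvPolynomial.eval p (P x)

/-- Polynomially graded bivector field: brackets of fiberwise polynomials of degree `≤ h`
and `≤ k` are fiberwise polynomials of degree `≤ h + k`. -/
def PolyGraded {n : ℕ} (W : Biv n) : Prop :=
  ∀ (h k : ℕ) (F G : Cot n → ℝ), Sm F → Sm G → PolyDeg h F → PolyDeg k G →
    PolyDeg (h + k) (bkt W F G)

/-- Graded bivector field: brackets of fiberwise homogeneous polynomials of degrees `h`, `k`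
are fiberwise homogeneous of degree `h + k`. -/
def HGraded {n : ℕ} (W : Biv n) : Prop :=
  ∀ (h k : ℕ) (F G : Cot n → ℝ), Sm F → Sm G → HomogPoly h F → HomogPoly k G →
    HomogPoly (h + k) (bkt W F G)

/-- The momentum `m(X)` of a vector field `X` on `M`. -/
def mmt {n : ℕ} (X : Vec n → Vec n) (z : Cot n) : ℝ := ∑ i, z.2 i * X z.1 i

/-- The quadratic fiberwise polynomial `s(Q)` of a symmetric 2-contravariant tensor field. -/
def sQ {n : ℕ} (G : Vec n → Fin n → Fin n → ℝ) (z : Cot n) : ℝ :=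
  ∑ i, ∑ j, G z.1 i j * z.2 i * z.2 j

/-- `W` is `π`-related to `w`: the projection `π : T*M → M` is a Poisson mapping. -/
def PiRel {n : ℕ} (W : Biv n) (w : Vec n → Fin n → Fin n → ℝ) : Prop :=
  ∀ f g : Vec n → ℝ, Sm f → Sm g → ∀ z : Cot n,
    bkt W (fun y => f y.1) (fun y => g y.1) z = bktM w f g z.1

/-- Foliated function of the vertical foliation of `T*M`: constant on the fibers. -/
def FolV {n : ℕ} (F : Cot n → ℝ) : Prop := ∀ (x p p' : Vec n), F (x, p) = F (x, p')

/-- Transversal Poisson structure of the vertical foliation of `T*M`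
(semi-Poisson structure): the bracket restricts to a Lie bracket on foliated functions. -/
def SemiPoissonT {n : ℕ} (W : Biv n) : Prop :=
  (∀ F G, Sm F → Sm G → FolV F → FolV G → FolV (bkt W F G)) ∧
  (∀ F G H, Sm F → Sm G → Sm H → FolV F → FolV G → FolV H → ∀ z,
    bkt W (bkt W F G) H z + bkt W (bkt W G H) F z + bkt W (bkt W H F) G z = 0)

/-- The `w`-Hamiltonian vector field of `f` : `(X_f^w)^j = w^{ij} ∂_i f`. -/
def ham {n : ℕ} (w : Vec n → Fin n → Fin n → ℝ) (f : Vec n → ℝ) (x : Vec n) (j : Fin n) : ℝ :=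
  ∑ i, w x i j * pd i f x

/-- Contravariant derivative of a vector field, with coefficients
`D_{dx^i} ∂_j = -Γ^{ik}_j ∂_k`, applied in the direction `df`:
`(D_{df}X)^j = ∂_i f (w^{ib} ∂_b X^j - Γ^{ij}_k X^k)`. -/
def Dvec {n : ℕ} (w : Vec n → Fin n → Fin n → ℝ) (Γ : Vec n → Fin n → Fin n → Fin n → ℝ)
    (f : Vec n → ℝ) (X : Vec n → Vec n) (x : Vec n) (j : Fin n) : ℝ :=
  ∑ i, pd i f x *
    ((∑ b, w x i b * pd b (fun y => X y j) x) - ∑ k, Γ x i j k * X x k)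

/-- The extension of the contravariant derivative `D_{df}` to symmetric 2-tensor fields. -/
def Dten2 {n : ℕ} (w : Vec n → Fin n → Fin n → ℝ) (Γ : Vec n → Fin n → Fin n → Fin n → ℝ)
    (f : Vec n → ℝ) (G : Vec n → Fin n → Fin n → ℝ) (x : Vec n) (i j : Fin n) : ℝ :=
  (∑ a, ∑ b, w x a b * pd a f x * pd b (fun y => G y i j) x)
   - (∑ a, ∑ h, pd a f x * Γ x a i h * G x h j)
   - (∑ a, ∑ h, pd a f x * Γ x a j h * G x i h)

def SmoothVF {n : ℕ} (X : Vec n → Vec n) : Prop := ∀ i, Sm fun x => X x i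
def SmoothGam {n : ℕ} (Γ : Vec n → Fin n → Fin n → Fin n → ℝ) : Prop :=
  ∀ i j k, Sm fun x => Γ x i j k

/-- The horizontal derivative `δ/δx^i = ∂/∂x^i - N_{ia} ∂/∂p_a`. -/
def delx {n : ℕ} (N : Cot n → Fin n → Fin n → ℝ) (i : Fin n) (F : Cot n → ℝ) (z : Cot n) : ℝ :=
  Dxx i F z - ∑ a, N z i a * Dpp a F z

/-- The horizontal lift `w^H = (1/2) w^{ij} δ/δx^i ∧ δ/δx^j`, in natural coordinates. -/
def WH {n : ℕ} (w : Vec n → Fin n → Fin n → ℝ) (N : Cot n → Fin n → Fin n → ℝ) : Biv n :=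
  fun z a b =>
    match a, b with
    | Sum.inl i, Sum.inl j => w z.1 i j
    | Sum.inl i, Sum.inr b => -∑ j, w z.1 i j * N z j b
    | Sum.inr a, Sum.inl j => ∑ i, w z.1 j i * N z i a
    | Sum.inr a, Sum.inr b => ∑ i, ∑ j, w z.1 i j * N z i a * N z j b

/-- The connection on `T*M` induced by a linear connection: `N_{ij} = -p_k Γ^k_{ij}`. -/
def NLin {n : ℕ} (Γup : Vec n → Fin n → Fin n → Fin n → ℝ) (z : Cot n) (i j : Fin n) : ℝ :=
  -∑ k, z.2 k * Γup z.1 k i j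

/-- Components `R^h_{kij}` of the curvature of the linear connection `∇`. -/
def Rnabla {n : ℕ} (Γup : Vec n → Fin n → Fin n → Fin n → ℝ)
    (x : Vec n) (h k i j : Fin n) : ℝ :=
  pd i (fun y => Γup y h j k) x - pd j (fun y => Γup y h i k) x
    + (∑ l, Γup x h i l * Γup x l j k) - ∑ l, Γup x h j l * Γup x l i k

/-- The covariant derivative `∇_{X_f^w}` (the contravariant derivative induced by `∇`). -/
def DvecL {n : ℕ} (w : Vec n → Fin n → Fin n → ℝ) (Γup : Vec n → Fin n → Fin n → Fin n → ℝ)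
    (f : Vec n → ℝ) (X : Vec n → Vec n) (x : Vec n) (j : Fin n) : ℝ :=
  (∑ k, ham w f x k * pd k (fun y => X y j) x)
    + ∑ k, ∑ l, Γup x j k l * ham w f x k * X x l

theorem Sm.fderiv_apply_vec {E : Type*} [NormedAddCommGroup E] [NormedSpace ℝ E]
    {F : E → ℝ} (hF : Sm F) {V : E → E} (hV : Sm V) : Sm fun z => fderiv ℝ F z (V z) :=
  (ContDiff.fderiv_right (m := ((⊤ : ℕ∞) : WithTop ℕ∞)) hF (by simp)).clm_apply hV

theorem Sm.differentiable {E F : Type*} [NormedAddCommGroup E] [NormedSpace ℝ E]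
    [NormedAddCommGroup F] [NormedSpace ℝ F] {f : E → F} (hf : Sm f) : Differentiable ℝ f :=
  ContDiff.differentiable hf (by simp)

theorem Sm.pd {n : ℕ} {f : Vec n → ℝ} (hf : Sm f) (i : Fin n) : Sm (pd i f) :=
  Sm.fderiv_apply_vec hf contDiff_const

/-- The horizontal lift of `∂/∂x^i` for the nonlinear connection induced by `Γ`. -/
def hvec {n : ℕ} (Γ : Vec n → Fin n → Fin n → Fin n → ℝ) (i : Fin n) (z : Cot n) : Cot n :=
  (Pi.single i 1, fun a => ∑ h, z.2 h * Γ z.1 h i a)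

theorem delx_eq_fderiv {n : ℕ} (Γ : Vec n → Fin n → Fin n → Fin n → ℝ) (i : Fin n)
    (F : Cot n → ℝ) (z : Cot n) : delx (NLin Γ) i F z = fderiv ℝ F z (hvec Γ i z) := by
  have h : hvec Γ i z = dirOf (Sum.inl i) - ∑ a, NLin Γ z i a • dirOf (Sum.inr a) := by
    refine Prod.ext ?_ ?_
    · simp [hvec, dirOf, Prod.fst_sum]
    · ext b
      simp [hvec, dirOf, Prod.snd_sum, NLin, Finset.sum_apply, Pi.single_apply]
  rw [h, map_sub, map_sum]
  simp [delx, Dxx, Dpp, DT]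

theorem sm_hvec {n : ℕ} {Γ : Vec n → Fin n → Fin n → Fin n → ℝ} (hΓ : SmoothGam Γ)
    (i : Fin n) : Sm (hvec Γ i) := by
  refine ContDiff.prodMk contDiff_const (contDiff_pi.2 fun a => ContDiff.sum fun h _ => ?_)
  exact ((contDiff_apply ℝ ℝ h).comp contDiff_snd).mul (ContDiff.comp (hΓ h i a) contDiff_fst)

theorem sm_delx {n : ℕ} {Γ : Vec n → Fin n → Fin n → Fin n → ℝ} (hΓ : SmoothGam Γ)
    (i : Fin n) {F : Cot n → ℝ} (hF : Sm F) : Sm (delx (NLin Γ) i F) := by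
  rw [show delx (NLin Γ) i F = _ from funext (delx_eq_fderiv Γ i F)]
  exact Sm.fderiv_apply_vec hF (sm_hvec hΓ i)

theorem bkt_WH {n : ℕ} {w : Vec n → Fin n → Fin n → ℝ} (hw : SkewM w)
    (N : Cot n → Fin n → Fin n → ℝ) (F G : Cot n → ℝ) (z : Cot n) :
    bkt (WH w N) F G z = ∑ i, ∑ j, w z.1 i j * delx N i F z * delx N j G z := by
  have e : ∀ i j, w z.1 i j * delx N i F z * delx N j G z
      = w z.1 i j * Dxx i F z * Dxx j G z
        - (∑ b, w z.1 i j * N z j b * Dxx i F z * Dpp b G z)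
        - (∑ a, w z.1 i j * N z i a * Dpp a F z * Dxx j G z)
        + ∑ a, ∑ b, w z.1 i j * N z i a * N z j b * Dpp a F z * Dpp b G z := by
    intro i j
    have e1 : ∑ b, w z.1 i j * N z j b * Dxx i F z * Dpp b G z
        = w z.1 i j * Dxx i F z * ∑ b, N z j b * Dpp b G z := by
      rw [Finset.mul_sum]; exact Finset.sum_congr rfl fun _ _ => by ring
    have e2 : ∑ a, w z.1 i j * N z i a * Dpp a F z * Dxx j G z
        = w z.1 i j * (∑ a, N z i a * Dpp a F z) * Dxx j G z := by
      rw [Finset.mul_sum, Finset.sum_mul]; exact Finset.sum_congr rfl fun _ _ => by ring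
    have e3 : ∑ a, ∑ b, w z.1 i j * N z i a * N z j b * Dpp a F z * Dpp b G z
        = w z.1 i j * (∑ a, N z i a * Dpp a F z) * ∑ b, N z j b * Dpp b G z := by
      rw [mul_assoc, Finset.sum_mul_sum, Finset.mul_sum]
      refine Finset.sum_congr rfl fun _ _ => ?_
      rw [Finset.mul_sum]; exact Finset.sum_congr rfl fun _ _ => by ring
    rw [e1, e2, e3, delx, delx]; ring
  simp_rw [e, Finset.sum_add_distrib, Finset.sum_sub_distrib]
  have t2 : ∑ i, ∑ b, (-∑ j, w z.1 i j * N z j b) * Dxx i F z * Dpp b G z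
      = -∑ i, ∑ j, ∑ b, w z.1 i j * N z j b * Dxx i F z * Dpp b G z := by
    rw [← Finset.sum_neg_distrib]
    refine Finset.sum_congr rfl fun i _ => ?_
    rw [Finset.sum_comm, ← Finset.sum_neg_distrib]
    refine Finset.sum_congr rfl fun b _ => ?_
    simp [Finset.sum_mul]
  have t3 : ∑ a, ∑ j, (∑ i, w z.1 j i * N z i a) * Dpp a F z * Dxx j G z
      = -∑ i, ∑ j, ∑ a, w z.1 i j * N z i a * Dpp a F z * Dxx j G z := by
    rw [Finset.sum_comm, Finset.sum_comm (f := fun i j => ∑ a, w z.1 i j * N z i a *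
      Dpp a F z * Dxx j G z), ← Finset.sum_neg_distrib]
    refine Finset.sum_congr rfl fun j _ => ?_
    rw [Finset.sum_comm, ← Finset.sum_neg_distrib]
    refine Finset.sum_congr rfl fun a _ => ?_
    rw [Finset.sum_mul, Finset.sum_mul, ← Finset.sum_neg_distrib]
    refine Finset.sum_congr rfl fun i _ => ?_
    rw [hw z.1 j i]; ring
  have t4 : ∑ a, ∑ b, (∑ i, ∑ j, w z.1 i j * N z i a * N z j b) * Dpp a F z * Dpp b G z
      = ∑ i, ∑ j, ∑ a, ∑ b, w z.1 i j * N z i a * N z j b * Dpp a F z * Dpp b G z := by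
    simp_rw [Finset.sum_mul]
    calc _ = ∑ a, ∑ i, ∑ b, ∑ j, w z.1 i j * N z i a * N z j b * Dpp a F z * Dpp b G z :=
          Finset.sum_congr rfl fun a _ => Finset.sum_comm
      _ = ∑ i, ∑ a, ∑ b, ∑ j, w z.1 i j * N z i a * N z j b * Dpp a F z * Dpp b G z :=
          Finset.sum_comm
      _ = ∑ i, ∑ a, ∑ j, ∑ b, w z.1 i j * N z i a * N z j b * Dpp a F z * Dpp b G z :=
          Finset.sum_congr rfl fun i _ => Finset.sum_congr rfl fun a _ => Finset.sum_comm
      _ = _ := Finset.sum_congr rfl fun i _ => Finset.sum_comm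
  simp only [bkt, Fintype.sum_sum_type, WH, Finset.sum_add_distrib]
  change ∑ i, ∑ j, w z.1 i j * Dxx i F z * Dxx j G z
    + ∑ a, ∑ j, (∑ i, w z.1 j i * N z i a) * Dpp a F z * Dxx j G z
    + (∑ i, ∑ b, (-∑ j, w z.1 i j * N z j b) * Dxx i F z * Dpp b G z
    + ∑ a, ∑ b, (∑ i, ∑ j, w z.1 i j * N z i a * N z j b) * Dpp a F z * Dpp b G z) = _
  rw [t2, t3, t4]; ring

theorem bkt_WH_skew {n : ℕ} {w : Vec n → Fin n → Fin n → ℝ} (hw : SkewM w)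
    (N : Cot n → Fin n → Fin n → ℝ) (F G : Cot n → ℝ) (z : Cot n) :
    bkt (WH w N) F G z = -bkt (WH w N) G F z := by
  rw [bkt_WH hw, bkt_WH hw, Finset.sum_comm, ← Finset.sum_neg_distrib]
  refine Finset.sum_congr rfl fun i _ => ?_
  rw [← Finset.sum_neg_distrib]
  refine Finset.sum_congr rfl fun j _ => ?_
  rw [hw z.1 j i]; ring

theorem bkt_neg_right {n : ℕ} (W : Biv n) (F G : Cot n → ℝ) (z : Cot n) :
    bkt W F (fun y => -G y) z = -bkt W F G z := by
  simp only [bkt, DT, fderiv_fun_neg, neg_apply, mul_neg, Finset.sum_neg_distrib]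

theorem fderiv_fiberLinear {n : ℕ} {c : Vec n → Fin n → ℝ} (hc : ∀ h, Sm fun x => c x h)
    (z v : Cot n) : fderiv ℝ (fun y : Cot n => ∑ h, y.2 h * c y.1 h) z v
      = ∑ h, (v.2 h * c z.1 h + z.2 h * fderiv ℝ (fun x => c x h) z.1 v.1) := by
  have key : ∀ h, HasFDerivAt (fun y : Cot n => y.2 h * c y.1 h)
      (z.2 h • (fderiv ℝ (fun x => c x h) z.1).comp (ContinuousLinearMap.fst ℝ (Vec n) (Vec n))
        + c z.1 h • (ContinuousLinearMap.proj h).comp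
          (ContinuousLinearMap.snd ℝ (Vec n) (Vec n))) z := by
    intro h
    refine HasFDerivAt.mul (c := fun y : Cot n => y.2 h) (d := fun y : Cot n => c y.1 h) ?_ ?_
    · exact ((ContinuousLinearMap.proj (R := ℝ) (φ := fun _ : Fin n => ℝ) h).comp
        (ContinuousLinearMap.snd ℝ (Vec n) (Vec n))).hasFDerivAt
    · exact HasFDerivAt.comp z ((hc h).differentiable z.1).hasFDerivAt hasFDerivAt_fst
  rw [(HasFDerivAt.fun_sum fun h _ => key h).fderiv]
  simp only [sum_apply]
  refine Finset.sum_congr rfl fun h _ => ?_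
  simp; ring

theorem fderiv_comp_fst {n : ℕ} {f : Vec n → ℝ} (hf : Sm f) (z v : Cot n) :
    fderiv ℝ (fun y : Cot n => f y.1) z v = fderiv ℝ f z.1 v.1 := by
  rw [(HasFDerivAt.comp (g := f) (f := Prod.fst) z (hf.differentiable z.1).hasFDerivAt
    hasFDerivAt_fst).fderiv (f := fun y : Cot n => f y.1)]
  simp

theorem delx_comp_fst {n : ℕ} (Γ : Vec n → Fin n → Fin n → Fin n → ℝ) {f : Vec n → ℝ}
    (hf : Sm f) (i : Fin n) (z : Cot n) :
    delx (NLin Γ) i (fun y => f y.1) z = pd i f z.1 := by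
  rw [delx_eq_fderiv, fderiv_comp_fst hf]; rfl

theorem delx_mmt {n : ℕ} (Γ : Vec n → Fin n → Fin n → Fin n → ℝ) {X : Vec n → Vec n}
    (hX : SmoothVF X) (i : Fin n) (z : Cot n) :
    delx (NLin Γ) i (mmt X) z
      = ∑ h, z.2 h * (pd i (fun x => X x h) z.1 + ∑ a, Γ z.1 h i a * X z.1 a) := by
  rw [delx_eq_fderiv]
  refine (fderiv_fiberLinear hX z _).trans ?_
  simp only [hvec, Finset.sum_add_distrib, mul_add, Finset.mul_sum, Finset.sum_mul, pd]
  rw [add_comm, Finset.sum_comm]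
  simp only [mul_assoc]

/-- The commutator of horizontal derivatives, expressed by the curvature. -/
def curvOp {n : ℕ} (Γ : Vec n → Fin n → Fin n → Fin n → ℝ) (F : Cot n → ℝ) (z : Cot n)
    (i j : Fin n) : ℝ :=
  ∑ a, ∑ h, z.2 h * Dpp a F z * Rnabla Γ z.1 h a i j

theorem fderiv_hvec {n : ℕ} {Γ : Vec n → Fin n → Fin n → Fin n → ℝ} (hΓ : SmoothGam Γ)
    (i k : Fin n) (z : Cot n) : fderiv ℝ (hvec Γ i) z (hvec Γ k z)
      = (0, fun a => ∑ h, z.2 h * (pd k (fun x => Γ x h i a) z.1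
          + ∑ l, Γ z.1 h k l * Γ z.1 l i a)) := by
  have hd : ∀ a, Differentiable ℝ fun y : Cot n => ∑ h, y.2 h * Γ y.1 h i a := fun a =>
    Sm.differentiable <| ContDiff.sum fun h _ =>
      ((contDiff_apply ℝ ℝ h).comp contDiff_snd).mul (ContDiff.comp (hΓ h i a) contDiff_fst)
  have h1 : HasFDerivAt (hvec Γ i) ((0 : Cot n →L[ℝ] Vec n).prod (ContinuousLinearMap.pi fun a =>
      fderiv ℝ (fun y : Cot n => ∑ h, y.2 h * Γ y.1 h i a) z)) z :=
    (hasFDerivAt_const _ _).prodMk (hasFDerivAt_pi.2 fun a => (hd a z).hasFDerivAt)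
  rw [h1.fderiv]
  refine Prod.ext rfl ?_
  ext a
  refine (fderiv_fiberLinear (fun h => hΓ h i a) z _).trans ?_
  simp only [hvec, Finset.sum_add_distrib, mul_add, Finset.mul_sum, Finset.sum_mul, pd]
  rw [add_comm, Finset.sum_comm]
  simp only [mul_assoc]

theorem delx_comm {n : ℕ} {Γ : Vec n → Fin n → Fin n → Fin n → ℝ} (hΓ : SmoothGam Γ)
    {F : Cot n → ℝ} (hF : Sm F) (i j : Fin n) (z : Cot n) :
    delx (NLin Γ) i (delx (NLin Γ) j F) z - delx (NLin Γ) j (delx (NLin Γ) i F) z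
      = curvOp Γ F z i j := by
  have hF' : Differentiable ℝ (fderiv ℝ F) :=
    Sm.differentiable (ContDiff.fderiv_right (m := ((⊤ : ℕ∞) : WithTop ℕ∞)) hF (by simp))
  have e : ∀ i j, delx (NLin Γ) i (delx (NLin Γ) j F) z
      = fderiv ℝ (fderiv ℝ F) z (hvec Γ i z) (hvec Γ j z)
        + fderiv ℝ F z (fderiv ℝ (hvec Γ j) z (hvec Γ i z)) := by
    intro i j
    rw [show delx (NLin Γ) j F = _ from funext (delx_eq_fderiv Γ j F), delx_eq_fderiv,
      fderiv_clm_apply (hF' z) ((sm_hvec hΓ j).differentiable z)]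
    simp [add_comm]
  have hs : IsSymmSndFDerivAt ℝ F z :=
    (ContDiff.contDiffAt hF).isSymmSndFDerivAt
      (by simpa using WithTop.coe_le_coe.2 (le_top : (2 : ℕ∞) ≤ ⊤))
  rw [e i j, e j i, hs (hvec Γ i z) (hvec Γ j z), add_sub_add_left_eq_sub, ← map_sub,
    fderiv_hvec hΓ, fderiv_hvec hΓ]
  have h : ∀ u : Vec n, ((0, u) : Cot n) = ∑ a, u a • dirOf (Sum.inr a) := by
    intro u
    refine Prod.ext ?_ ?_
    · simp [dirOf, Prod.fst_sum]
    · ext b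
      simp [dirOf, Prod.snd_sum, Finset.sum_apply, Pi.single_apply]
  rw [Prod.mk_sub_mk, sub_zero, h, map_sum, curvOp]
  refine Finset.sum_congr rfl fun a _ => ?_
  rw [map_smul, smul_eq_mul, Pi.sub_apply, ← Finset.sum_sub_distrib, Finset.sum_mul]
  refine Finset.sum_congr rfl fun h _ => ?_
  simp only [Rnabla, Dpp, DT]
  ring

/-- The contraction of `K` with the vectors `♯_w C` and `♯_w B`. -/
def sharpContr {n : ℕ} (w K : Fin n → Fin n → ℝ) (C B : Fin n → ℝ) : ℝ :=
  ∑ i, ∑ j, K i j * (∑ l, w l i * C l) * (∑ l, w l j * B l)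

theorem sharpContr_swap {n : ℕ} (w K : Fin n → Fin n → ℝ) (C B : Fin n → ℝ) :
    sharpContr w K C B = sharpContr w (fun i j => K j i) B C := by
  rw [sharpContr, Finset.sum_comm]
  exact Finset.sum_congr rfl fun _ _ => Finset.sum_congr rfl fun _ _ => by ring

theorem sharpContr_sub {n : ℕ} (w K L : Fin n → Fin n → ℝ) (C B : Fin n → ℝ) :
    sharpContr w (fun i j => K i j - L i j) C B = sharpContr w K C B - sharpContr w L C B := by
  simp only [sharpContr, sub_mul, Finset.sum_sub_distrib]

theorem nested_sum {n : ℕ} {w : Fin n → Fin n → ℝ} (hw : ∀ i j, w i j = -w j i)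
    (dw : Fin n → Fin n → Fin n → ℝ) (A B C : Fin n → ℝ) (A2 B2 : Fin n → Fin n → ℝ) :
    ∑ k, ∑ l, w k l * (∑ i, ∑ j, (dw k i j * A i * B j + w i j * A2 k i * B j
        + w i j * A i * B2 k j)) * C l
      = (∑ i, ∑ j, ∑ l, (∑ k, w k l * dw k i j) * A i * B j * C l)
        + sharpContr w A2 C B - sharpContr w B2 C A := by
  have hl : ∀ (c : Fin n → ℝ) k, ∑ l, w l k * c l = -∑ l, w k l * c l := by
    intro c k
    rw [← Finset.sum_neg_distrib]
    exact Finset.sum_congr rfl fun l _ => by rw [hw l k]; ring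
  have h1 : ∑ i, ∑ j, ∑ l, (∑ k, w k l * dw k i j) * A i * B j * C l
      = ∑ k, (∑ l, w k l * C l) * ∑ i, ∑ j, dw k i j * A i * B j := by
    simp only [Finset.sum_mul, Finset.mul_sum]
    calc _ = ∑ i, ∑ j, ∑ k, ∑ l, w k l * dw k i j * A i * B j * C l :=
          Finset.sum_congr rfl fun i _ => Finset.sum_congr rfl fun j _ => Finset.sum_comm
      _ = ∑ i, ∑ k, ∑ j, ∑ l, w k l * dw k i j * A i * B j * C l :=
          Finset.sum_congr rfl fun i _ => Finset.sum_comm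
      _ = ∑ k, ∑ i, ∑ j, ∑ l, w k l * dw k i j * A i * B j * C l := Finset.sum_comm
      _ = _ := by
        refine Finset.sum_congr rfl fun k _ => Finset.sum_congr rfl fun i _ =>
          Finset.sum_congr rfl fun j _ => Finset.sum_congr rfl fun l _ => by ring
  rw [h1, sharpContr, sharpContr, ← Finset.sum_add_distrib, ← Finset.sum_sub_distrib]
  refine Finset.sum_congr rfl fun k _ => ?_
  rw [show ∀ S : ℝ, ∑ l, w k l * S * C l = (∑ l, w k l * C l) * S from fun S => by
    rw [Finset.sum_mul]; exact Finset.sum_congr rfl fun _ _ => by ring]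
  have h2 : ∑ i, ∑ j, w i j * A2 k i * B j = ∑ i, A2 k i * ∑ j, w i j * B j := by
    refine Finset.sum_congr rfl fun i _ => ?_
    rw [Finset.mul_sum]; exact Finset.sum_congr rfl fun _ _ => by ring
  have h3 : ∑ i, ∑ j, w i j * A i * B2 k j = ∑ j, B2 k j * ∑ i, w i j * A i := by
    rw [Finset.sum_comm]
    refine Finset.sum_congr rfl fun i _ => ?_
    rw [Finset.mul_sum]; exact Finset.sum_congr rfl fun _ _ => by ring
  simp only [Finset.sum_add_distrib]
  rw [h2, h3, hl C k]
  simp only [mul_assoc, mul_left_comm _ (-∑ l, w k l * C l), ← Finset.mul_sum]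
  simp only [hl B, mul_neg, Finset.sum_neg_distrib]
  ring

theorem pd_coord {n : ℕ} (β : Vec n) (i : Fin n) (x : Vec n) :
    pd i (fun y => ∑ l, β l * y l) x = β i := by
  have h : HasFDerivAt (fun y : Vec n => ∑ l, β l * y l)
      (∑ l, β l • (ContinuousLinearMap.proj l : Vec n →L[ℝ] ℝ)) x :=
    HasFDerivAt.fun_sum fun l _ =>
      ((ContinuousLinearMap.proj (R := ℝ) (φ := fun _ : Fin n => ℝ) l).hasFDerivAt).const_mul (β l)
  rw [pd, h.fderiv]
  simp [Pi.single_apply]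

theorem sm_coord {n : ℕ} (β : Vec n) : Sm fun y : Vec n => ∑ l, β l * y l :=
  ContDiff.sum fun l _ => contDiff_const.mul (contDiff_apply ℝ ℝ l)

theorem JacobiM.tensor {n : ℕ} {w : Vec n → Fin n → Fin n → ℝ} (hw : JacobiM w) (x : Vec n)
    (i j l : Fin n) :
    (∑ k, w x k l * pd k (fun y => w y i j) x) + (∑ k, w x k i * pd k (fun y => w y j l) x)
      + (∑ k, w x k j * pd k (fun y => w y l i) x) = 0 := by
  have h1 : ∀ i j, bktM w (fun y => ∑ m, (Pi.single i 1 : Vec n) m * y m)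
      (fun y => ∑ m, (Pi.single j 1 : Vec n) m * y m) = fun y => w y i j := by
    intro i j
    ext y
    simp only [bktM, pd_coord]
    simp [Pi.single_apply]
  have h2 : ∀ (f : Vec n → ℝ) j, bktM w f (fun y => ∑ m, (Pi.single j 1 : Vec n) m * y m) x
      = ∑ k, w x k j * pd k f x := by
    intro f j
    simp only [bktM, pd_coord]
    simp [Pi.single_apply]
  have := hw _ _ _ (sm_coord (Pi.single i 1)) (sm_coord (Pi.single j 1))
    (sm_coord (Pi.single l 1)) x
  rwa [h1, h1, h1, h2, h2, h2] at this

theorem bkt_bkt_WH {n : ℕ} {w : Vec n → Fin n → Fin n → ℝ} (hw : SkewM w) (hs : SmoothM w)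
    {Γ : Vec n → Fin n → Fin n → Fin n → ℝ} (hΓ : SmoothGam Γ) {F G : Cot n → ℝ}
    (hF : Sm F) (hG : Sm G) (H : Cot n → ℝ) (z : Cot n) :
    bkt (WH w (NLin Γ)) (bkt (WH w (NLin Γ)) F G) H z
      = (∑ i, ∑ j, ∑ l, (∑ k, w z.1 k l * pd k (fun x => w x i j) z.1)
            * delx (NLin Γ) i F z * delx (NLin Γ) j G z * delx (NLin Γ) l H z)
        + sharpContr (w z.1) (fun k i => delx (NLin Γ) k (delx (NLin Γ) i F) z)
            (fun l => delx (NLin Γ) l H z) (fun l => delx (NLin Γ) l G z)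
        - sharpContr (w z.1) (fun k i => delx (NLin Γ) k (delx (NLin Γ) i G) z)
            (fun l => delx (NLin Γ) l H z) (fun l => delx (NLin Γ) l F z) := by
  rw [bkt_WH hw, ← nested_sum (hw z.1)]
  refine Finset.sum_congr rfl fun k _ => Finset.sum_congr rfl fun l _ => ?_
  congr 2
  rw [show bkt (WH w (NLin Γ)) F G = _ from funext (bkt_WH hw (NLin Γ) F G), delx_eq_fderiv]
  have hd : ∀ i j, HasFDerivAt
      (fun y : Cot n => w y.1 i j * delx (NLin Γ) i F y * delx (NLin Γ) j G y)
      ((w z.1 i j * delx (NLin Γ) i F z) • fderiv ℝ (delx (NLin Γ) j G) z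
        + delx (NLin Γ) j G z • (w z.1 i j • fderiv ℝ (delx (NLin Γ) i F) z
          + delx (NLin Γ) i F z • fderiv ℝ (fun y : Cot n => w y.1 i j) z)) z := by
    intro i j
    have h0 : Sm fun y : Cot n => w y.1 i j := ContDiff.comp (hs i j) contDiff_fst
    exact ((h0.differentiable z).hasFDerivAt.mul
      ((sm_delx hΓ i hF).differentiable z).hasFDerivAt).mul
      ((sm_delx hΓ j hG).differentiable z).hasFDerivAt
  rw [(HasFDerivAt.fun_sum fun i _ => HasFDerivAt.fun_sum fun j _ => hd i j).fderiv]
  simp only [sum_apply]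
  refine Finset.sum_congr rfl fun i _ => Finset.sum_congr rfl fun j _ => ?_
  simp only [add_apply, smul_apply, smul_eq_mul,
    ← delx_eq_fderiv]
  rw [delx_comp_fst Γ (hs i j)]
  ring

theorem jacobiator_WH {n : ℕ} {w : Vec n → Fin n → Fin n → ℝ} (hw : PoissonM w)
    {Γ : Vec n → Fin n → Fin n → Fin n → ℝ} (hΓ : SmoothGam Γ) {F G H : Cot n → ℝ}
    (hF : Sm F) (hG : Sm G) (hH : Sm H) (z : Cot n) :
    bkt (WH w (NLin Γ)) (bkt (WH w (NLin Γ)) F G) H z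
        + bkt (WH w (NLin Γ)) (bkt (WH w (NLin Γ)) G H) F z
        + bkt (WH w (NLin Γ)) (bkt (WH w (NLin Γ)) H F) G z
      = sharpContr (w z.1) (curvOp Γ F z)
            (fun l => delx (NLin Γ) l H z) (fun l => delx (NLin Γ) l G z)
        + sharpContr (w z.1) (curvOp Γ G z)
            (fun l => delx (NLin Γ) l F z) (fun l => delx (NLin Γ) l H z)
        + sharpContr (w z.1) (curvOp Γ H z)
            (fun l => delx (NLin Γ) l G z) (fun l => delx (NLin Γ) l F z) := by
  obtain ⟨hsk, hsm, hj⟩ := hw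
  have hc : ∀ {F : Cot n → ℝ}, Sm F → curvOp Γ F z = fun k i =>
      delx (NLin Γ) k (delx (NLin Γ) i F) z - delx (NLin Γ) i (delx (NLin Γ) k F) z :=
    fun hF => funext fun k => funext fun i => (delx_comm hΓ hF k i z).symm
  rw [hc hF, hc hG, hc hH, sharpContr_sub, sharpContr_sub, sharpContr_sub,
    sharpContr_swap _ (fun k i => delx (NLin Γ) i (delx (NLin Γ) k F) z),
    sharpContr_swap _ (fun k i => delx (NLin Γ) i (delx (NLin Γ) k G) z),
    sharpContr_swap _ (fun k i => delx (NLin Γ) i (delx (NLin Γ) k H) z),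
    bkt_bkt_WH hsk hsm hΓ hF hG, bkt_bkt_WH hsk hsm hΓ hG hH, bkt_bkt_WH hsk hsm hΓ hH hF]
  have key : ∀ A B C : Fin n → ℝ,
      (∑ i, ∑ j, ∑ l, (∑ k, w z.1 k l * pd k (fun x => w x i j) z.1) * A i * B j * C l)
      + (∑ i, ∑ j, ∑ l, (∑ k, w z.1 k l * pd k (fun x => w x i j) z.1) * B i * C j * A l)
      + (∑ i, ∑ j, ∑ l, (∑ k, w z.1 k l * pd k (fun x => w x i j) z.1) * C i * A j * B l)
        = 0 := by
    intro A B C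
    have e1 : ∑ i, ∑ j, ∑ l, (∑ k, w z.1 k l * pd k (fun x => w x i j) z.1) * B i * C j * A l
        = ∑ i, ∑ j, ∑ l, (∑ k, w z.1 k i * pd k (fun x => w x j l) z.1) * B j * C l * A i := by
      calc _ = ∑ i, ∑ l, ∑ j, (∑ k, w z.1 k l * pd k (fun x => w x i j) z.1)
            * B i * C j * A l := Finset.sum_congr rfl fun _ _ => Finset.sum_comm
        _ = _ := Finset.sum_comm
    have e2 : ∑ i, ∑ j, ∑ l, (∑ k, w z.1 k l * pd k (fun x => w x i j) z.1) * C i * A j * B l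
        = ∑ i, ∑ j, ∑ l, (∑ k, w z.1 k j * pd k (fun x => w x l i) z.1) * C l * A i * B j := by
      rw [Finset.sum_comm]
      exact Finset.sum_congr rfl fun _ _ => Finset.sum_comm
    rw [e1, e2]
    simp only [← Finset.sum_add_distrib]
    refine Finset.sum_eq_zero fun i _ => Finset.sum_eq_zero fun j _ =>
      Finset.sum_eq_zero fun l _ => ?_
    linear_combination (A i * B j * C l) * hj.tensor z.1 i j l
  linear_combination key (fun l => delx (NLin Γ) l F z) (fun l => delx (NLin Γ) l G z)
    (fun l => delx (NLin Γ) l H z)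

theorem sharpContr_zero {n : ℕ} (w : Fin n → Fin n → ℝ) (C B : Fin n → ℝ) :
    sharpContr w 0 C B = 0 := by
  simp [sharpContr]

theorem sharpContr_sum_mul {n : ℕ} {ι : Type*} (s : Finset ι) (w : Fin n → Fin n → ℝ)
    (c : ι → ℝ) (K : ι → Fin n → Fin n → ℝ) (C B : Fin n → ℝ) :
    sharpContr w (fun i j => ∑ a ∈ s, c a * K a i j) C B
      = ∑ a ∈ s, c a * sharpContr w (K a) C B := by
  have key : ∀ S T : Fin n → ℝ, ∑ i, ∑ j, (∑ a ∈ s, c a * K a i j) * S i * T j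
      = ∑ a ∈ s, c a * ∑ i, ∑ j, K a i j * S i * T j := by
    intro S T
    simp only [Finset.sum_mul, Finset.mul_sum]
    rw [Finset.sum_comm (s := s)]
    refine Finset.sum_congr rfl fun i _ => ?_
    rw [Finset.sum_comm (s := s)]
    exact Finset.sum_congr rfl fun j _ => Finset.sum_congr rfl fun a _ => by ring
  exact key _ _

theorem sharpContr_curvOp {n : ℕ} (w : Fin n → Fin n → ℝ)
    (Γ : Vec n → Fin n → Fin n → Fin n → ℝ) (F : Cot n → ℝ) (z : Cot n) (C B : Fin n → ℝ) :
    sharpContr w (curvOp Γ F z) C B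
      = ∑ a, ∑ h, z.2 h * Dpp a F z * sharpContr w (Rnabla Γ z.1 h a) C B := by
  have h := sharpContr_sum_mul Finset.univ w (fun p : Fin n × Fin n => z.2 p.2 * Dpp p.1 F z)
    (fun p => Rnabla Γ z.1 p.2 p.1) C B
  simp only [Fintype.sum_prod_type] at h
  exact h

theorem curvOp_comp_fst {n : ℕ} (Γ : Vec n → Fin n → Fin n → Fin n → ℝ) {f : Vec n → ℝ}
    (hf : Sm f) (z : Cot n) : curvOp Γ (fun y => f y.1) z = 0 := by
  ext i j
  simp [curvOp, Dpp, DT, fderiv_comp_fst hf, dirOf]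

theorem Dpp_mmt {n : ℕ} {X : Vec n → Vec n} (hX : SmoothVF X) (a : Fin n) (z : Cot n) :
    Dpp a (mmt X) z = X z.1 a := by
  refine (fderiv_fiberLinear hX z _).trans ?_
  simp [dirOf, Pi.single_apply]

theorem sm_mmt {n : ℕ} {X : Vec n → Vec n} (hX : SmoothVF X) : Sm (mmt X) :=
  ContDiff.sum fun h _ =>
    ((contDiff_apply ℝ ℝ h).comp contDiff_snd).mul (ContDiff.comp (hX h) contDiff_fst)

theorem sm_comp_fst {n : ℕ} {f : Vec n → ℝ} (hf : Sm f) : Sm fun y : Cot n => f y.1 :=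
  ContDiff.comp hf contDiff_fst

theorem bkt_comp_fst_mmt {n : ℕ} {w : Vec n → Fin n → Fin n → ℝ} (hw : SkewM w)
    (Γ : Vec n → Fin n → Fin n → Fin n → ℝ) {f : Vec n → ℝ} (hf : Sm f) {X : Vec n → Vec n}
    (hX : SmoothVF X) :
    bkt (WH w (NLin Γ)) (fun y => f y.1) (mmt X) = mmt (DvecL w Γ f X) := by
  ext z
  rw [bkt_WH hw, Finset.sum_comm]
  simp only [delx_comp_fst Γ hf, delx_mmt Γ hX]
  have e : ∀ k, ∑ i, w z.1 i k * pd i f z.1 * ∑ h, z.2 h * (pd k (fun x => X x h) z.1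
      + ∑ a, Γ z.1 h k a * X z.1 a) = ∑ h, z.2 h * (ham w f z.1 k * pd k (fun x => X x h) z.1
      + ∑ a, Γ z.1 h k a * ham w f z.1 k * X z.1 a) := by
    intro k
    rw [← Finset.sum_mul, Finset.mul_sum]
    refine Finset.sum_congr rfl fun h _ => ?_
    rw [mul_left_comm, mul_add, Finset.mul_sum]
    change z.2 h * (ham w f z.1 k * _ + ∑ a, ham w f z.1 k * _) = _
    congr 2
    exact Finset.sum_congr rfl fun _ _ => by ring
  simp only [e]
  rw [Finset.sum_comm]
  simp only [mmt, DvecL, ← Finset.mul_sum, Finset.sum_add_distrib]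

theorem bkt_comp_fst {n : ℕ} {w : Vec n → Fin n → Fin n → ℝ} (hw : SkewM w)
    (Γ : Vec n → Fin n → Fin n → Fin n → ℝ) {f g : Vec n → ℝ} (hf : Sm f) (hg : Sm g) :
    bkt (WH w (NLin Γ)) (fun y => f y.1) (fun y => g y.1) = fun y => bktM w f g y.1 := by
  ext z
  rw [bkt_WH hw]
  simp only [delx_comp_fst Γ hf, delx_comp_fst Γ hg, bktM]

theorem sm_bktM {n : ℕ} {w : Vec n → Fin n → Fin n → ℝ} (hw : SmoothM w) {f g : Vec n → ℝ}
    (hf : Sm f) (hg : Sm g) : Sm (bktM w f g) :=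
  ContDiff.sum fun i _ => ContDiff.sum fun j _ =>
    (ContDiff.mul (hw i j) (hf.pd i)).mul (hg.pd j)

theorem smoothVF_DvecL {n : ℕ} {w : Vec n → Fin n → Fin n → ℝ} (hw : SmoothM w)
    {Γ : Vec n → Fin n → Fin n → Fin n → ℝ} (hΓ : SmoothGam Γ) {f : Vec n → ℝ} (hf : Sm f)
    {X : Vec n → Vec n} (hX : SmoothVF X) : SmoothVF (DvecL w Γ f X) := by
  intro j
  have hh : ∀ k, Sm fun x => ham w f x k := fun k =>
    ContDiff.sum fun i _ => ContDiff.mul (hw i k) (hf.pd i)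
  exact ContDiff.add (ContDiff.sum fun k _ => ContDiff.mul (hh k) ((hX j).pd k))
    (ContDiff.sum fun k _ => ContDiff.sum fun l _ =>
      (ContDiff.mul (hΓ j k l) (hh k)).mul (hX l))

theorem jacobiator_mmt {n : ℕ} {w : Vec n → Fin n → Fin n → ℝ} (hw : PoissonM w)
    {Γ : Vec n → Fin n → Fin n → Fin n → ℝ} (hΓ : SmoothGam Γ) {f g : Vec n → ℝ}
    (hf : Sm f) (hg : Sm g) {X : Vec n → Vec n} (hX : SmoothVF X) (z : Cot n) :
    bkt (WH w (NLin Γ)) (bkt (WH w (NLin Γ)) (fun y => f y.1) (fun y => g y.1)) (mmt X) z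
        + bkt (WH w (NLin Γ)) (bkt (WH w (NLin Γ)) (fun y => g y.1) (mmt X)) (fun y => f y.1) z
        + bkt (WH w (NLin Γ)) (bkt (WH w (NLin Γ)) (mmt X) (fun y => f y.1)) (fun y => g y.1) z
      = -∑ i, z.2 i * (DvecL w Γ f (DvecL w Γ g X) z.1 i - DvecL w Γ g (DvecL w Γ f X) z.1 i
          - DvecL w Γ (bktM w f g) X z.1 i) := by
  obtain ⟨hsk, hsm, -⟩ := hw
  rw [bkt_comp_fst hsk Γ hf hg, bkt_comp_fst_mmt hsk Γ (sm_bktM hsm hf hg) hX,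
    bkt_comp_fst_mmt hsk Γ hg hX, bkt_WH_skew hsk _ (mmt _) (fun y => f y.1),
    bkt_comp_fst_mmt hsk Γ hf (smoothVF_DvecL hsm hΓ hg hX),
    show bkt (WH w (NLin Γ)) (mmt X) (fun y => f y.1) = _ from
      funext (bkt_WH_skew hsk _ (mmt X) (fun y => f y.1)),
    bkt_comp_fst_mmt hsk Γ hf hX, bkt_WH_skew hsk, bkt_neg_right,
    bkt_comp_fst_mmt hsk Γ hg (smoothVF_DvecL hsm hΓ hf hX)]
  simp only [mmt, mul_sub, Finset.sum_sub_distrib]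
  ring

/-- for the connection induced by a linear connection `∇`, the horizontal
lift `w^H` of a Poisson structure `w` is Poisson iff `R_∇(♯_w α, ♯_w β)Z = 0` for all
`α, β, Z`, equivalently iff the curvature `C_D` of the induced contravariant connection
`D = ∇_{♯_w ·}` vanishes. -/
theorem stmt16 {n : ℕ} (w : Vec n → Fin n → Fin n → ℝ) (hw : PoissonM w)
    (Γup : Vec n → Fin n → Fin n → Fin n → ℝ) (hΓ : SmoothGam Γup) :
    (JacobiT (WH w (NLin Γup)) ↔
      (∀ x (α β : Vec n) (h k : Fin n),
        ∑ i, ∑ j, Rnabla Γup x h k i j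
          * (∑ l, w x l i * α l) * (∑ l, w x l j * β l) = 0)) ∧
    (JacobiT (WH w (NLin Γup)) ↔
      (∀ (f g : Vec n → ℝ) (X : Vec n → Vec n), Sm f → Sm g → SmoothVF X →
        ∀ x i, DvecL w Γup f (fun y l => DvecL w Γup g X y l) x i
          - DvecL w Γup g (fun y l => DvecL w Γup f X y l) x i
          - DvecL w Γup (bktM w f g) X x i = 0)) := by
  have hRJ : (∀ x (α β : Vec n) (h k : Fin n),
      sharpContr (w x) (Rnabla Γup x h k) α β = 0) → JacobiT (WH w (NLin Γup)) := by
    intro hR F G H hF hG hH z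
    rw [jacobiator_WH hw hΓ hF hG hH]
    simp only [sharpContr_curvOp, hR, mul_zero, Finset.sum_const_zero, add_zero]
  have hJC : JacobiT (WH w (NLin Γup)) →
      ∀ (f g : Vec n → ℝ) (X : Vec n → Vec n), Sm f → Sm g → SmoothVF X →
        ∀ x i, DvecL w Γup f (DvecL w Γup g X) x i - DvecL w Γup g (DvecL w Γup f X) x i
          - DvecL w Γup (bktM w f g) X x i = 0 := by
    intro hJ f g X hf hg hX x i
    have h := hJ _ _ _ (sm_comp_fst hf) (sm_comp_fst hg) (sm_mmt hX) (x, Pi.single i 1)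
    rw [jacobiator_mmt hw hΓ hf hg hX] at h
    simp only [Pi.single_apply, ite_mul, one_mul, zero_mul, Finset.sum_ite_eq',
      Finset.mem_univ, if_true] at h
    exact neg_eq_zero.1 h
  have hCR : (∀ (f g : Vec n → ℝ) (X : Vec n → Vec n), Sm f → Sm g → SmoothVF X →
        ∀ x i, DvecL w Γup f (DvecL w Γup g X) x i - DvecL w Γup g (DvecL w Γup f X) x i
          - DvecL w Γup (bktM w f g) X x i = 0) →
      ∀ x (α β : Vec n) (h k : Fin n), sharpContr (w x) (Rnabla Γup x h k) α β = 0 := by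
    intro hC x α β h k
    have hX : SmoothVF fun _ : Vec n => (Pi.single k 1 : Vec n) := fun _ => contDiff_const
    have e := jacobiator_mmt hw hΓ (sm_coord β) (sm_coord α) hX (x, Pi.single h 1)
    simp only [hC _ _ _ (sm_coord β) (sm_coord α) hX] at e
    rw [jacobiator_WH hw hΓ (sm_comp_fst (sm_coord β)) (sm_comp_fst (sm_coord α)) (sm_mmt hX),
      curvOp_comp_fst Γup (sm_coord β), curvOp_comp_fst Γup (sm_coord α), sharpContr_zero,
      sharpContr_zero, sharpContr_curvOp] at e
    simp only [delx_comp_fst Γup (sm_coord _), pd_coord, Dpp_mmt hX] at e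
    simpa [Pi.single_apply] using e
  exact ⟨⟨fun hJ => hCR (hJC hJ), hRJ⟩, ⟨hJC, fun hC => hRJ (hCR hC)⟩⟩
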